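/- Let F be an algebraically closed field of characteristic different from 2, fix i ∈ F with i² = −1, and let g₁ = [[1, −i, 0], [−i, 1, 0], [0, 0, 1]]. For g ∈ SL₃(F), there exist k ∈ SO(3,F) and an upper triangular matrix b ∈ GL₃(F) with g = k g₁ b if and only if c₁(g) = 0 and c₃(g) ≠ 0. -/

import Mathlib

open Matrix

/-- The standard symmetric bilinear form on `R³`: `(v,w) = ∑ i, v i * w i`. -/
def bil {R : Type*} [CommRing R] (v w : Fin 3 → R) : R := ∑ j, v j * w j

/-- The `j`-th column of a 3×3 matrix. -/
def vcol {R : Type*} (g : Matrix (Fin 3) (Fin 3) R) (j : Fin 3) : Fin 3 → R :=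
  fun i => g i j

/-- Membership in `SO(3,R)`: `kᵀk = 1` and `det k = 1`. -/
def SO3 {R : Type*} [CommRing R] (g : Matrix (Fin 3) (Fin 3) R) : Prop :=
  gᵀ * g = 1 ∧ g.det = 1

/-- A 3×3 matrix is upper triangular. -/
def UpperTri {R : Type*} [CommRing R] (b : Matrix (Fin 3) (Fin 3) R) : Prop :=
  ∀ i j : Fin 3, j < i → b i j = 0

/-- `c₁(g) = (v₁(g), v₁(g))`. -/
def c1 {R : Type*} [CommRing R] (g : Matrix (Fin 3) (Fin 3) R) : R :=
  bil (vcol g 0) (vcol g 0)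

/-- `c₂(g) = (v₁(g),v₁(g))(v₂(g),v₂(g)) − (v₁(g),v₂(g))²`. -/
def c2 {R : Type*} [CommRing R] (g : Matrix (Fin 3) (Fin 3) R) : R :=
  bil (vcol g 0) (vcol g 0) * bil (vcol g 1) (vcol g 1) - (bil (vcol g 0) (vcol g 1)) ^ 2

/-- `c₃(g) = (v₁(g), v₂(g))`. -/
def c3 {R : Type*} [CommRing R] (g : Matrix (Fin 3) (Fin 3) R) : R :=
  bil (vcol g 0) (vcol g 1)

/-!
Statement 12: Over an algebraically closed field `F` of characteristic ≠ 2 with a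
fixed `i` satisfying `i² = −1`, and `g₁ = [[1,−i,0],[−i,1,0],[0,0,1]]`, a matrix
`g ∈ SL₃(F)` factors as `g = k g₁ b` with `k ∈ SO(3,F)` and `b` upper triangular
invertible iff `c₁(g) = 0` and `c₃(g) ≠ 0`.
-/

/-- The Gram matrix of `g₁ b`, in terms of the Gram matrix of `g₁`. -/
lemma gram_mul_eq {R : Type*} [CommRing R] {i : R} (hi : i ^ 2 = -1)
    (b : Matrix (Fin 3) (Fin 3) R) :
    (!![1, -i, 0; -i, 1, 0; 0, 0, 1] * b)ᵀ * (!![1, -i, 0; -i, 1, 0; 0, 0, 1] * b) =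
      bᵀ * (!![0, -2 * i, 0; -2 * i, 0, 0; 0, 0, 1] * b) := by
  have h : (!![1, -i, 0; -i, 1, 0; 0, 0, 1] : Matrix (Fin 3) (Fin 3) R)ᵀ *
      !![1, -i, 0; -i, 1, 0; 0, 0, 1] = !![0, -2 * i, 0; -2 * i, 0, 0; 0, 0, 1] := by
    have hii : 1 + i * i = 0 := by linear_combination hi
    ext j k
    fin_cases j <;> fin_cases k <;>
      simp [Matrix.mul_apply, Fin.sum_univ_three, hii, add_comm (i * i), two_mul, ← sub_eq_add_neg]
  rw [transpose_mul, Matrix.mul_assoc, ← Matrix.mul_assoc _ _ b, h]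

/-- Two matrices of determinant one with the same Gram matrix differ by an element of `SO(3)`
on the left. -/
lemma exists_SO3_mul_eq_of_gram_eq {R : Type*} [CommRing R] {g m : Matrix (Fin 3) (Fin 3) R}
    (hg : g.det = 1) (hm : m.det = 1) (h : mᵀ * m = gᵀ * g) :
    ∃ k, SO3 k ∧ g = k * m := by
  have hu : IsUnit m.det := by simp [hm]
  have hut : IsUnit mᵀ.det := by simp [hm]
  refine ⟨g * m⁻¹, ⟨?_, ?_⟩, ?_⟩
  · calc (g * m⁻¹)ᵀ * (g * m⁻¹) = (m⁻¹)ᵀ * (gᵀ * g) * m⁻¹ := by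
          simp only [transpose_mul, Matrix.mul_assoc]
      _ = (mᵀ⁻¹ * mᵀ) * (m * m⁻¹) := by
          rw [← h, transpose_nonsing_inv]; simp only [Matrix.mul_assoc]
      _ = 1 := by rw [nonsing_inv_mul _ hut, mul_nonsing_inv _ hu, one_mul]
  · rw [det_mul, hg, det_nonsing_inv, hm]; simp
  · rw [Matrix.mul_assoc, nonsing_inv_mul _ hu, mul_one]

/-- A symmetric matrix of determinant one with vanishing `(0,0)` entry and nonzero `(0,1)` entry
is the Gram matrix of `g₁ b` for some upper triangular `b` with `det (g₁ b) = 1`. -/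
lemma exists_upperTri_gram_eq {F : Type*} [Field F] (hchar : (2 : F) ≠ 0) {i : F}
    (hi : i ^ 2 = -1) {c d e f h : F} (hc : c ≠ 0)
    (hdet : (!![0, c, e; c, d, f; e, f, h] : Matrix (Fin 3) (Fin 3) F).det = 1) :
    ∃ b : Matrix (Fin 3) (Fin 3) F, UpperTri b ∧ IsUnit b.det ∧
      (!![1, -i, 0; -i, 1, 0; 0, 0, 1] * b).det = 1 ∧
      (!![1, -i, 0; -i, 1, 0; 0, 0, 1] * b)ᵀ * (!![1, -i, 0; -i, 1, 0; 0, 0, 1] * b) =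
        !![0, c, e; c, d, f; e, f, h] := by
  let b : Matrix (Fin 3) (Fin 3) F :=
    !![1, d / (2 * c), (f - d / (2 * c) * e) / c; 0, c * i / 2, e * i / 2; 0, 0, -i / c]
  have hbdet : b.det = 1 / 2 := by
    simp only [b, det_fin_three]
    simp
    field_simp
    linear_combination -hi
  refine ⟨b, ?_, ?_, ?_, ?_⟩
  · intro j k hjk
    fin_cases j <;> fin_cases k <;> simp_all [b]
  · rw [hbdet]; simpa using hchar
  · rw [det_mul, hbdet, det_fin_three]
    simp
    field_simp
    linear_combination -hi
  · rw [gram_mul_eq hi]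
    simp [det_fin_three] at hdet
    ext j k
    fin_cases j <;> fin_cases k <;>
      simp [b, Matrix.mul_apply, Fin.sum_univ_three] <;> field_simp
    · linear_combination -hi
    · linear_combination -e * hi
    · linear_combination -hi
    · linear_combination -2 * d * hi
    · linear_combination -2 * c * f * hi
    · linear_combination -e * hi
    · linear_combination -2 * c * f * hi
    · linear_combination (-2 * e * (2 * c * f - d * e) + 2) * hi + 2 * hdet

theorem factorization_middle_orbit_one {F : Type*} [Field F] [IsAlgClosed F]
    (hchar : (2 : F) ≠ 0) (i : F) (hi : i ^ 2 = -1)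
    (g : Matrix (Fin 3) (Fin 3) F) (hg : g.det = 1) :
    (∃ k b : Matrix (Fin 3) (Fin 3) F, SO3 k ∧ UpperTri b ∧ IsUnit b.det ∧
        g = k * !![1, -i, 0; -i, 1, 0; 0, 0, 1] * b)
      ↔ (c1 g = 0 ∧ c3 g ≠ 0) := by
  constructor
  · rintro ⟨k, b, ⟨hk, -⟩, hb, hbu, rfl⟩
    have h10 : b 1 0 = 0 := hb 1 0 (by decide)
    have h20 : b 2 0 = 0 := hb 2 0 (by decide)
    have h21 : b 2 1 = 0 := hb 2 1 (by decide)
    have hi0 : i ≠ 0 := by rintro rfl; simp at hi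
    have hd : b.det ≠ 0 := hbu.ne_zero
    rw [det_fin_three, h10, h20, h21] at hd
    have h0 : b 0 0 ≠ 0 := by intro h; simp [h] at hd
    have h1 : b 1 1 ≠ 0 := by intro h; simp [h] at hd
    have hgram : ∀ m : Matrix (Fin 3) (Fin 3) F, (k * m)ᵀ * (k * m) = mᵀ * m := fun m => by
      rw [transpose_mul, Matrix.mul_assoc, ← Matrix.mul_assoc kᵀ, hk, one_mul]
    rw [Matrix.mul_assoc]
    have hc1 : ∀ m : Matrix (Fin 3) (Fin 3) F, c1 m = (mᵀ * m) 0 0 := fun _ => rfl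
    have hc3 : ∀ m : Matrix (Fin 3) (Fin 3) F, c3 m = (mᵀ * m) 0 1 := fun _ => rfl
    rw [hc1, hc3, hgram, gram_mul_eq hi]
    simp [mul_apply, Fin.sum_univ_three, vecMul, dotProduct, h10, h20, h21, h0, h1, hi0, hchar]
  · rintro ⟨h1, h3⟩
    have hG : gᵀ * g = !![0, c3 g, (gᵀ * g) 0 2; c3 g, (gᵀ * g) 1 1, (gᵀ * g) 1 2;
        (gᵀ * g) 0 2, (gᵀ * g) 1 2, (gᵀ * g) 2 2] := by
      have hsymm : ∀ j k, (gᵀ * g) j k = (gᵀ * g) k j := fun j k =>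
        congrFun (congrFun (isSymm_transpose_mul_self g) k) j
      ext j k
      fin_cases j <;> fin_cases k
      · exact h1
      · rfl
      · rfl
      · exact hsymm 1 0
      · rfl
      · rfl
      · exact hsymm 2 0
      · exact hsymm 2 1
      · rfl
    have hGdet : (gᵀ * g).det = 1 := by rw [det_mul, det_transpose, hg, one_mul]
    rw [hG] at hGdet
    obtain ⟨b, hb, hbu, hdet, hgram⟩ := exists_upperTri_gram_eq hchar hi h3 hGdet
    obtain ⟨k, hk, hgk⟩ := exists_SO3_mul_eq_of_gram_eq hg hdet (hgram.trans hG.symm)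
    exact ⟨k, b, hk, hb, hbu, by rw [hgk, Matrix.mul_assoc]⟩
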